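/- arXiv:2201.03305 — 2 statements merged into one kernel-verified Lean document; each statement's English description precedes it below -/
import Mathlib

section
/- Let n ∈ ℕ₀, λ ∈ ℂ∖{0}, let V:ℝ→ℂ be n+3 times differentiable on an open set U ⊂ ℝ on which V_λ(x) := λ − V(x) ∈ ℂ∖(−∞,0], and let ψ₋₁, ψ₀, …, ψ_{n−1} be functions on U whose derivatives satisfy the WKB recursion. Then for every k ∈ {−1, 0, …, n−1} and every m ∈ {1, …, n+3−k}, there exist functions d_{k+m,0}, d_{k+m,1}, …, d_{k+m,k+m} with d_{k+m,j} ∈ D_{k+m,j} for each j, such that on U: ψ_k^{(m)}(x) = λ^k · V_λ(x)^{−k/4} · Σ_{j=0}^{k+m} d_{k+m,j}(x) / V_λ(x)^j (all fractional powers of V_λ taken as principal powers). Moreover d_{r,0} = 0 whenever r ≥ 1. -/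
open Finset Set

noncomputable section

/-- Pairs `(α₁,α₂)` with `αᵢ ∈ {−1,…,n−1}` and `α₁+α₂ = s`. -/
def wkbPairs (n : ℕ) (s : ℤ) : Finset (ℤ × ℤ) :=
  ((Finset.Icc (-1:ℤ) ((n:ℤ)-1)) ×ˢ (Finset.Icc (-1:ℤ) ((n:ℤ)-1))).filter
    (fun p => p.1 + p.2 = s)

/-- Triples `(α₁,α₂,α₃)` with `αᵢ ∈ {−1,…,n−1}` and `α₁+α₂+α₃ = s`. -/
def wkbTriples (n : ℕ) (s : ℤ) : Finset (ℤ × ℤ × ℤ) :=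
  ((Finset.Icc (-1:ℤ) ((n:ℤ)-1)) ×ˢ (Finset.Icc (-1:ℤ) ((n:ℤ)-1)) ×ˢ
    (Finset.Icc (-1:ℤ) ((n:ℤ)-1))).filter (fun p => p.1 + p.2.1 + p.2.2 = s)

/-- Quadruples `(α₁,α₂,α₃,α₄)` with `αᵢ ∈ {−1,…,n−1}` and `α₁+α₂+α₃+α₄ = s`. -/
def wkbQuads (n : ℕ) (s : ℤ) : Finset (ℤ × ℤ × ℤ × ℤ) :=
  ((Finset.Icc (-1:ℤ) ((n:ℤ)-1)) ×ˢ (Finset.Icc (-1:ℤ) ((n:ℤ)-1)) ×ˢ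
    (Finset.Icc (-1:ℤ) ((n:ℤ)-1)) ×ˢ (Finset.Icc (-1:ℤ) ((n:ℤ)-1))).filter
    (fun p => p.1 + p.2.1 + p.2.2.1 + p.2.2.2 = s)

/-- The WKB recursion for the biharmonic operator: on `U` (where `λ − V` avoids
the slit `(−∞,0]`), `ψ₋₁' = iλ⁻¹(λ−V)^{1/4}` (principal fourth root), the
recursion for `ψ_{k+1}'`, and the convention `ψ_α = 0` for `α ≤ −2` or `α ≥ n`. -/
def WKBRec (n : ℕ) (lam : ℂ) (V : ℝ → ℂ) (U : Set ℝ) (ψ : ℤ → ℝ → ℂ) : Prop :=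
  (∀ a : ℤ, a ≤ -2 → ψ a = 0) ∧
  (∀ a : ℤ, (n:ℤ) ≤ a → ψ a = 0) ∧
  (∀ x ∈ U, deriv (ψ (-1)) x = Complex.I * lam⁻¹ * (lam - V x) ^ ((1:ℂ)/4)) ∧
  (∀ k : ℤ, -1 ≤ k → k ≤ (n:ℤ) - 2 → ∀ x ∈ U,
    deriv (ψ (k+1)) x = (4 * (deriv (ψ (-1)) x)^3)⁻¹ *
      (iteratedDeriv 4 (ψ (k-2)) x
        - 4 * ∑ p ∈ wkbPairs n (k-2), deriv (ψ p.1) x * iteratedDeriv 3 (ψ p.2) x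
        - 3 * ∑ p ∈ wkbPairs n (k-2),
            iteratedDeriv 2 (ψ p.1) x * iteratedDeriv 2 (ψ p.2) x
        + 6 * ∑ p ∈ wkbTriples n (k-2),
            deriv (ψ p.1) x * deriv (ψ p.2.1) x * iteratedDeriv 2 (ψ p.2.2) x
        - ∑ p ∈ (wkbQuads n (k-2)).filter
            (fun p => p.1 ≠ k+1 ∧ p.2.1 ≠ k+1 ∧ p.2.2.1 ≠ k+1 ∧ p.2.2.2 ≠ k+1),
            deriv (ψ p.1) x * deriv (ψ p.2.1) x * deriv (ψ p.2.2.1) x *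
              deriv (ψ p.2.2.2) x))

/-- The index set `I_{r,j}`. -/
def WKBIdx (r j : ℕ) : Finset (Fin (r - j + 1) → ℕ) :=
  (Fintype.piFinset fun _ => Finset.range (r + 1)).filter
    (fun α => (∑ p : Fin (r - j + 1), (p.1 + 1) * α p) = r ∧
      (∑ p : Fin (r - j + 1), α p) = j)

/-- The class `D_{r,j}` of linear combinations of products of derivatives of `V`. -/
def Dset (V : ℝ → ℂ) (r j : ℕ) : Set (ℝ → ℂ) :=
  {f | ∃ c : (Fin (r - j + 1) → ℕ) → ℂ,
    f = fun x => ∑ α ∈ WKBIdx r j,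
      c α * ∏ p : Fin (r - j + 1), (iteratedDeriv (p.1 + 1) V x) ^ (α p)}

/-- Functions obtained from generators `q i` of weight `i + 1` and constants of weight `0` by
weight-homogeneous sums and products. -/
inductive IsGraded (q : ℕ → ℝ → ℂ) : ℤ → (ℝ → ℂ) → Prop
  | const (c : ℂ) : IsGraded q 0 (fun _ => c)
  | zero (r : ℕ) : IsGraded q r (fun _ => 0)
  | gen (i : ℕ) : IsGraded q ((i : ℤ) + 1) (q i)
  | add {r : ℤ} {f g : ℝ → ℂ} (hf : IsGraded q r f) (hg : IsGraded q r g) :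
      IsGraded q r (fun x => f x + g x)
  | mul {r s : ℤ} {f g : ℝ → ℂ} (hf : IsGraded q r f) (hg : IsGraded q s g) :
      IsGraded q (r + s) (fun x => f x * g x)

theorem IsGraded.nonneg {q : ℕ → ℝ → ℂ} {r : ℤ} {f : ℝ → ℂ} (h : IsGraded q r f) : 0 ≤ r := by
  induction h with
  | const c => exact le_rfl
  | zero r => positivity
  | gen i => positivity
  | add _ _ h _ => exact h
  | mul _ _ h h' => exact add_nonneg h h'

theorem IsGraded.const_mul {q : ℕ → ℝ → ℂ} {r : ℤ} {f : ℝ → ℂ} (c : ℂ) (h : IsGraded q r f) :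
    IsGraded q r (fun x => c * f x) := by
  simpa using (IsGraded.const c).mul h

theorem IsGraded.exists_hasDerivAt {q : ℕ → ℝ → ℂ} {U : Set ℝ} {N : ℕ}
    (hq : ∀ i < N, ∀ x ∈ U, HasDerivAt (q i) (q (i + 1) x + q i x * q 0 x) x)
    {r : ℤ} {f : ℝ → ℂ} (h : IsGraded q r f) (hr : r ≤ N) :
    ∃ f', IsGraded q (r + 1) f' ∧ ∀ x ∈ U, HasDerivAt f (f' x) x := by
  induction h with
  | const c => exact ⟨_, .zero 1, fun x _ => hasDerivAt_const x c⟩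
  | zero r => exact ⟨_, by simpa using IsGraded.zero (r + 1), fun x _ => hasDerivAt_const x _⟩
  | gen i =>
    refine ⟨_, .add ?_ ?_, hq i (by omega)⟩
    · exact_mod_cast IsGraded.gen (i + 1)
    · simpa using (IsGraded.gen i).mul (IsGraded.gen 0)
  | add _ _ h h' =>
    obtain ⟨f', hf, hf'⟩ := h hr
    obtain ⟨g', hg, hg'⟩ := h' hr
    exact ⟨_, hf.add hg, fun x hx => (hf' x hx).add (hg' x hx)⟩
  | mul hf0 hg0 h h' =>
    have := hf0.nonneg
    have := hg0.nonneg
    obtain ⟨f', hf, hf'⟩ := h (by omega)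
    obtain ⟨g', hg, hg'⟩ := h' (by omega)
    refine ⟨_, .add ?_ ?_, fun x hx => (hf' x hx).mul (hg' x hx)⟩
    · convert hf.mul hg0 using 1; ring
    · convert hf0.mul hg using 1; ring

theorem IsGraded.exists_mvPolynomial {q : ℕ → ℝ → ℂ} {r : ℤ} {f : ℝ → ℂ} (h : IsGraded q r f) :
    ∃ P : MvPolynomial ℕ ℂ, P.IsWeightedHomogeneous (fun i : ℕ => (i : ℤ) + 1) r ∧
      ∀ x, f x = MvPolynomial.eval (fun i => q i x) P := by
  induction h with
  | const c => exact ⟨_, MvPolynomial.isWeightedHomogeneous_C _ c, by simp⟩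
  | zero r => exact ⟨0, MvPolynomial.isWeightedHomogeneous_zero _ _ _, by simp⟩
  | gen i => exact ⟨_, MvPolynomial.isWeightedHomogeneous_X _ _ i, by simp⟩
  | add _ _ h h' =>
    obtain ⟨P, hP, hP'⟩ := h
    obtain ⟨Q, hQ, hQ'⟩ := h'
    exact ⟨_, hP.add hQ, by simp [hP', hQ']⟩
  | mul _ _ h h' =>
    obtain ⟨P, hP, hP'⟩ := h
    obtain ⟨Q, hQ, hQ'⟩ := h'
    exact ⟨_, hP.mul hQ, by simp [hP', hQ']⟩

theorem Dset_sum_mem {ι : Type*} {V : ℝ → ℂ} {r j : ℕ} (S : Finset ι) (a : ι → ℂ)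
    (f : ι → ℝ → ℂ) (hf : ∀ s ∈ S, f s ∈ Dset V r j) :
    (fun x => ∑ s ∈ S, a s * f s x) ∈ Dset V r j := by
  classical
  induction S using Finset.induction_on with
  | empty => exact ⟨0, by simp⟩
  | insert s S hs ih =>
    obtain ⟨c, hc⟩ := hf s (by simp)
    obtain ⟨c', hc'⟩ := ih fun t ht => hf t (by simp [ht])
    refine ⟨fun α => a s * c α + c' α, funext fun x => ?_⟩
    rw [Finset.sum_insert hs, congrFun hc' x, hc, Finset.mul_sum, ← Finset.sum_add_distrib]
    exact Finset.sum_congr rfl fun α _ => by ring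

theorem eq_zero_of_mem_Dset_zero {V : ℝ → ℂ} {r : ℕ} (hr : 1 ≤ r) {f : ℝ → ℂ}
    (hf : f ∈ Dset V r 0) : f = fun _ => 0 := by
  obtain ⟨c, rfl⟩ := hf
  have h : WKBIdx r 0 = ∅ := by
    rw [WKBIdx, Finset.filter_eq_empty_iff]
    rintro α - ⟨h₁, h₂⟩
    rw [Finset.sum_eq_zero_iff] at h₂
    have : ∑ p : Fin (r - 0 + 1), (p.1 + 1) * α p = 0 :=
      Finset.sum_eq_zero fun p hp => by simp [h₂ p hp]
    omega
  simp [h]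

theorem monomial_mem_Dset (V : ℝ → ℂ) {r j : ℕ} (s : ℕ →₀ ℕ)
    (hr : ∑ i ∈ s.support, (i + 1) * s i = r) (hj : ∑ i ∈ s.support, s i = j) :
    (fun x => ∏ i ∈ s.support, iteratedDeriv (i + 1) V x ^ s i) ∈ Dset V r j := by
  classical
  have hrj : ∑ i ∈ s.support, i * s i = r - j := by
    rw [← hr, ← hj]
    simp [add_mul, Finset.sum_add_distrib]
  have hsub : s.support ⊆ Finset.range (r - j + 1) := fun i hi => by
    have h₁ := Finset.single_le_sum (f := fun i => i * s i) (fun _ _ => Nat.zero_le _) hi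
    have h₂ : 1 ≤ s i := Nat.one_le_iff_ne_zero.2 (Finsupp.mem_support_iff.1 hi)
    have h₃ : i ≤ i * s i := Nat.le_mul_of_pos_right i h₂
    simp only [Finset.mem_range]
    omega
  have hns : ∀ i, i ∉ s.support → s i = 0 := fun i hi => by simpa using hi
  have hmem : (fun p : Fin (r - j + 1) => s p) ∈ WKBIdx r j := by
    simp only [WKBIdx, Finset.mem_filter, Fintype.mem_piFinset, Finset.mem_range]
    refine ⟨fun p => ?_, ?_, ?_⟩
    · by_cases hp : (p : ℕ) ∈ s.support
      · have h₁ := Finset.single_le_sum (f := fun i => (i + 1) * s i)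
          (fun _ _ => Nat.zero_le _) hp
        have h₂ : s p ≤ (p + 1) * s p := Nat.le_mul_of_pos_left _ (Nat.succ_pos _)
        omega
      · rw [hns _ hp]; omega
    · rw [Fin.sum_univ_eq_sum_range (fun i => (i + 1) * s i)]
      exact (Finset.sum_subset hsub fun i _ hi => by simp [hns i hi]).symm.trans hr
    · rw [Fin.sum_univ_eq_sum_range (fun i => s i)]
      exact (Finset.sum_subset hsub fun i _ hi => hns i hi).symm.trans hj
  refine ⟨fun α => if α = (fun p : Fin (r - j + 1) => s p) then 1 else 0, funext fun x => ?_⟩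
  simp only [ite_mul, one_mul, zero_mul]
  rw [Finset.sum_ite_eq' (WKBIdx r j), if_pos hmem,
    Fin.prod_univ_eq_prod_range (fun i => iteratedDeriv (i + 1) V x ^ s i)]
  exact Finset.prod_subset hsub fun i _ hi => by simp [hns i hi]

theorem IsGraded.exists_Dset {lam : ℂ} {V : ℝ → ℂ} {r : ℕ} {g : ℝ → ℂ}
    (h : IsGraded (fun i x => iteratedDeriv (i + 1) V x / (lam - V x)) r g) :
    ∃ d : ℕ → ℝ → ℂ, (∀ j, d j ∈ Dset V r j) ∧
      ∀ x, g x = ∑ j ∈ Finset.range (r + 1), d j x / (lam - V x) ^ j := by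
  obtain ⟨P, hP, hg⟩ := h.exists_mvPolynomial
  have hw : ∀ s ∈ P.support, ∑ i ∈ s.support, (i + 1) * s i = r := fun s hs => by
    have := hP (MvPolynomial.mem_support_iff.1 hs)
    rw [Finsupp.weight_apply, Finsupp.sum] at this
    zify
    rw [← this]
    exact Finset.sum_congr rfl fun i _ => by simp [mul_comm]
  refine ⟨fun j x => ∑ s ∈ P.support with ∑ i ∈ s.support, s i = j, P.coeff s *
    ∏ i ∈ s.support, iteratedDeriv (i + 1) V x ^ s i, fun j => ?_, fun x => ?_⟩
  · refine Dset_sum_mem _ _ (fun (s : ℕ →₀ ℕ) x =>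
      ∏ i ∈ s.support, iteratedDeriv (i + 1) V x ^ s i) fun s hs => ?_
    rw [Finset.mem_filter] at hs
    exact monomial_mem_Dset V s (hw s hs.1) hs.2
  · rw [hg, MvPolynomial.eval_eq, ← Finset.sum_fiberwise_of_maps_to
      (t := Finset.range (r + 1)) (g := fun s => ∑ i ∈ s.support, s i)]
    · refine Finset.sum_congr rfl fun j _ => ?_
      rw [Finset.sum_div]
      refine Finset.sum_congr rfl fun s hs => ?_
      rw [Finset.mem_filter] at hs
      simp only [div_pow]
      rw [Finset.prod_div_distrib, Finset.prod_pow_eq_pow_sum, hs.2, mul_div_assoc]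
    · intro s hs
      rw [Finset.mem_range, Nat.lt_succ_iff, ← hw s hs]
      exact Finset.sum_le_sum fun i _ => Nat.le_mul_of_pos_left _ (Nat.succ_pos _)

/-- On `U`, the function `f` is `λ ^ k (λ - V) ^ (-k / 4)` times a polynomial of weight `r` in the
quotients `V⁽ⁱ⁺¹⁾ / (λ - V)`. -/
def WKBForm (lam : ℂ) (V : ℝ → ℂ) (U : Set ℝ) (k r : ℤ) (f : ℝ → ℂ) : Prop :=
  ∃ g, IsGraded (fun i x => iteratedDeriv (i + 1) V x / (lam - V x)) r g ∧
    ∀ x ∈ U, f x = lam ^ k * (lam - V x) ^ (-(k : ℂ) / 4) * g x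

namespace WKBForm

variable {lam : ℂ} {V : ℝ → ℂ} {U : Set ℝ} {k l r s : ℤ} {f g : ℝ → ℂ}

theorem congr (hf : WKBForm lam V U k r f) (h : ∀ x ∈ U, g x = f x) : WKBForm lam V U k r g := by
  obtain ⟨a, ha, hfa⟩ := hf
  exact ⟨a, ha, fun x hx => (h x hx).trans (hfa x hx)⟩

theorem const_mul (c : ℂ) (hf : WKBForm lam V U k r f) :
    WKBForm lam V U k r (fun x => c * f x) := by
  obtain ⟨a, ha, hfa⟩ := hf
  exact ⟨_, ha.const_mul c, fun x hx => by simp only [hfa x hx]; ring⟩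

theorem add (hf : WKBForm lam V U k r f) (hg : WKBForm lam V U k r g) :
    WKBForm lam V U k r (fun x => f x + g x) := by
  obtain ⟨a, ha, hfa⟩ := hf
  obtain ⟨b, hb, hgb⟩ := hg
  exact ⟨_, ha.add hb, fun x hx => by simp only [hfa x hx, hgb x hx]; ring⟩

theorem sub (hf : WKBForm lam V U k r f) (hg : WKBForm lam V U k r g) :
    WKBForm lam V U k r (fun x => f x - g x) :=
  (hf.add (hg.const_mul (-1))).congr fun x _ => by ring

theorem zero (hr : 0 ≤ r) : WKBForm lam V U k r (fun _ => 0) := by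
  lift r to ℕ using hr
  exact ⟨_, .zero r, by simp⟩

theorem sum {ι : Type*} (hr : 0 ≤ r) (S : Finset ι) (F : ι → ℝ → ℂ)
    (hF : ∀ i ∈ S, WKBForm lam V U k r (F i)) :
    WKBForm lam V U k r (fun x => ∑ i ∈ S, F i x) := by
  classical
  induction S using Finset.induction_on with
  | empty => simpa using zero hr
  | insert i S hi ih =>
    simp only [Finset.sum_insert hi]
    exact (hF i (by simp)).add (ih fun t ht => hF t (by simp [ht]))

theorem mul (hlam : lam ≠ 0) (hV : ∀ x ∈ U, lam - V x ≠ 0)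
    (hf : WKBForm lam V U k r f) (hg : WKBForm lam V U l s g) :
    WKBForm lam V U (k + l) (r + s) (fun x => f x * g x) := by
  obtain ⟨a, ha, hfa⟩ := hf
  obtain ⟨b, hb, hgb⟩ := hg
  refine ⟨_, ha.mul hb, fun x hx => ?_⟩
  have : -((k + l : ℤ) : ℂ) / 4 = -(k : ℂ) / 4 + -(l : ℂ) / 4 := by push_cast; ring
  simp only [hfa x hx, hgb x hx]
  rw [this, Complex.cpow_add _ _ (hV x hx), zpow_add₀ hlam]
  ring

theorem deriv {n : ℕ} (hU : IsOpen U)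
    (hV : ∀ m < n + 3, ∀ x ∈ U, DifferentiableAt ℝ (iteratedDeriv m V) x)
    (hslit : ∀ x ∈ U, lam - V x ∈ Complex.slitPlane)
    (hf : WKBForm lam V U k r f) (hr : r ≤ n + 2) :
    WKBForm lam V U k (r + 1) (deriv f) := by
  obtain ⟨a, ha, hfa⟩ := hf
  have hd : ∀ m < n + 3, ∀ x ∈ U,
      HasDerivAt (iteratedDeriv m V) (iteratedDeriv (m + 1) V x) x := fun m hm x hx => by
    rw [iteratedDeriv_succ]
    exact (hV m hm x hx).hasDerivAt
  have hW : ∀ x ∈ U, HasDerivAt (fun x => lam - V x) (-iteratedDeriv 1 V x) x := fun x hx => by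
    simpa using (hd 0 (by omega) x hx).const_sub lam
  obtain ⟨a', ha', haa'⟩ := ha.exists_hasDerivAt (U := U) (N := n + 2) (fun i hi x hx => by
    have h0 := Complex.slitPlane_ne_zero (hslit x hx)
    refine ((hd (i + 1) (by omega) x hx).div (hW x hx) h0).congr_deriv ?_
    simp only [zero_add]
    field_simp
    ring) (by exact_mod_cast hr)
  have hg : IsGraded (fun i x => iteratedDeriv (i + 1) V x / (lam - V x)) (r + 1)
      (fun x => (k : ℂ) / 4 * (iteratedDeriv 1 V x / (lam - V x) * a x)) := by
    convert ((IsGraded.gen 0).mul ha).const_mul ((k : ℂ) / 4) using 1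
    ring
  refine ⟨_, hg.add ha', fun x hx => ?_⟩
  have h0 := Complex.slitPlane_ne_zero (hslit x hx)
  have hp := ((Complex.hasStrictDerivAt_cpow_const (c := -(k : ℂ) / 4)
    (hslit x hx)).hasDerivAt.comp x (hW x hx)).const_mul (lam ^ k) |>.mul (haa' x hx)
  refine ((hp.congr_of_eventuallyEq ?_).deriv).trans ?_
  · filter_upwards [hU.mem_nhds hx] with y hy
    exact hfa y hy
  · rw [Complex.cpow_sub _ _ h0, Complex.cpow_one]
    simp only [Function.comp_apply]
    field_simp

end WKBForm

theorem WKBRec.wkbForm {n : ℕ} {lam : ℂ} (hlam : lam ≠ 0) {V : ℝ → ℂ} {U : Set ℝ}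
    (hU : IsOpen U)
    (hV : ∀ m < n + 3, ∀ x ∈ U, DifferentiableAt ℝ (iteratedDeriv m V) x)
    (hslit : ∀ x ∈ U, lam - V x ∈ Complex.slitPlane)
    {ψ : ℤ → ℝ → ℂ} (hψ : WKBRec n lam V U ψ) (N : ℕ) :
    ∀ k : ℤ, k + 2 ≤ N → k ≤ (n : ℤ) - 1 → ∀ m : ℕ, 1 ≤ m → -1 ≤ k →
      k + m ≤ n + 3 → WKBForm lam V U k (k + m) (iteratedDeriv m (ψ k)) := by
  obtain ⟨hneg, -, hinit, hrec⟩ := hψ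
  have hne : ∀ x ∈ U, lam - V x ≠ 0 := fun x hx => Complex.slitPlane_ne_zero (hslit x hx)
  induction N with
  | zero => intro k hk; omega
  | succ N ih =>
    intro k hkN hkn m hm hk hkm
    induction m, hm using Nat.le_induction with
    | succ m hm ihm =>
      rw [iteratedDeriv_succ]
      convert (ihm (by push_cast at hkm; omega)).deriv hU hV hslit (by push_cast at hkm; omega)
        using 1
      push_cast; ring
    | base =>
      rw [iteratedDeriv_one]
      obtain rfl | hk' := hk.eq_or_lt
      · refine ⟨_, .const Complex.I, fun x hx => ?_⟩
        rw [hinit x hx, zpow_neg_one]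
        push_cast
        rw [neg_neg]
        ring
      obtain ⟨k, rfl⟩ : ∃ l, k = l + 1 := ⟨k - 1, by ring⟩
      have key : ∀ (p : ℤ) (m : ℕ), -1 ≤ p → p ≤ k → 1 ≤ m → p + m ≤ n + 3 →
          WKBForm lam V U p (p + m) (iteratedDeriv m (ψ p)) := fun p m h₁ h₂ h₃ h₄ =>
        ih p (by push_cast at hkN; omega) (by omega) m h₃ h₁ h₄
      have key₁ : ∀ p : ℤ, -1 ≤ p → p ≤ k → WKBForm lam V U p (p + 1) (deriv (ψ p)) :=
        fun p h₁ h₂ => by simpa using key p 1 h₁ h₂ le_rfl (by push_cast; omega)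
      have hinv : WKBForm lam V U 3 0 (fun x => (4 * (deriv (ψ (-1)) x) ^ 3)⁻¹) := by
        refine ⟨_, .const (4 * Complex.I ^ 3)⁻¹, fun x hx => ?_⟩
        simp only [hinit x hx]
        rw [mul_pow, mul_pow, ← Complex.cpow_nat_mul]
        have : -((3 : ℤ) : ℂ) / 4 = -(((3 : ℕ) : ℂ) * (1 / 4)) := by push_cast; ring
        rw [this, Complex.cpow_neg]
        simp only [mul_inv, inv_pow, inv_inv]
        norm_cast
        ring
      have hfour : WKBForm lam V U (k - 2) (k + 2) (iteratedDeriv 4 (ψ (k - 2))) := by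
        by_cases h : k - 2 ≤ -2
        · have h₀ : iteratedDeriv 4 (0 : ℝ → ℂ) = fun _ => 0 := by
            funext x; simp [Pi.zero_def]
          rw [hneg _ h, h₀]
          exact WKBForm.zero (by omega)
        · convert key (k - 2) 4 (by omega) (by omega) (by omega) (by push_cast; omega) using 1
          push_cast; ring
      have hpair : ∀ p ∈ wkbPairs n (k - 2), ∀ i j : ℕ, 1 ≤ i → 1 ≤ j → i + j = 4 →
          WKBForm lam V U (k - 2) (k + 2)
            (fun x => iteratedDeriv i (ψ p.1) x * iteratedDeriv j (ψ p.2) x) := by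
        intro p hp i j hi hj hij
        simp only [wkbPairs, Finset.mem_filter, Finset.mem_product, Finset.mem_Icc] at hp
        convert (key p.1 i (by omega) (by omega) hi (by omega)).mul hlam hne
          (key p.2 j (by omega) (by omega) hj (by omega)) using 1 <;> omega
      have hpair₁ : ∀ p ∈ wkbPairs n (k - 2), WKBForm lam V U (k - 2) (k + 2)
          (fun x => deriv (ψ p.1) x * iteratedDeriv 3 (ψ p.2) x) := fun p hp => by
        simpa using hpair p hp 1 3 (by omega) (by omega) rfl
      have hpair₂ : ∀ p ∈ wkbPairs n (k - 2), WKBForm lam V U (k - 2) (k + 2)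
          (fun x => iteratedDeriv 2 (ψ p.1) x * iteratedDeriv 2 (ψ p.2) x) :=
        fun p hp => hpair p hp 2 2 (by omega) (by omega) rfl
      have htriple : ∀ p ∈ wkbTriples n (k - 2), WKBForm lam V U (k - 2) (k + 2)
          (fun x => deriv (ψ p.1) x * deriv (ψ p.2.1) x * iteratedDeriv 2 (ψ p.2.2) x) := by
        intro p hp
        simp only [wkbTriples, Finset.mem_filter, Finset.mem_product, Finset.mem_Icc] at hp
        convert ((key₁ p.1 (by omega) (by omega)).mul hlam hne
          (key₁ p.2.1 (by omega) (by omega))).mul hlam hne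
          (key p.2.2 2 (by omega) (by omega) (by omega) (by push_cast; omega)) using 1 <;>
          push_cast <;> omega
      have hquad : ∀ p ∈ (wkbQuads n (k - 2)).filter
            (fun p => p.1 ≠ k + 1 ∧ p.2.1 ≠ k + 1 ∧ p.2.2.1 ≠ k + 1 ∧ p.2.2.2 ≠ k + 1),
          WKBForm lam V U (k - 2) (k + 2) (fun x => deriv (ψ p.1) x * deriv (ψ p.2.1) x *
            deriv (ψ p.2.2.1) x * deriv (ψ p.2.2.2) x) := by
        intro p hp
        simp only [wkbQuads, Finset.mem_filter, Finset.mem_product, Finset.mem_Icc] at hp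
        convert (((key₁ p.1 (by omega) (by omega)).mul hlam hne
          (key₁ p.2.1 (by omega) (by omega))).mul hlam hne
          (key₁ p.2.2.1 (by omega) (by omega))).mul hlam hne
          (key₁ p.2.2.2 (by omega) (by omega)) using 1 <;> omega
      have hk₀ : 0 ≤ k + 2 := by omega
      have h := ((((hfour.sub ((WKBForm.sum hk₀ _ _ hpair₁).const_mul 4)).sub
        ((WKBForm.sum hk₀ _ _ hpair₂).const_mul 3)).add
        ((WKBForm.sum hk₀ _ _ htriple).const_mul 6)).sub (WKBForm.sum hk₀ _ _ hquad))
      have h' := (hinv.mul hlam hne h).congr (hrec k (by omega) (by omega))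
      convert h' using 1 <;> push_cast <;> ring

/-- structure of the WKB transport solutions, Lemma 3.2 of the paper.
If `ψ₋₁,…,ψ_{n−1}` satisfy the WKB recursion on an open `U` where
`V_λ = λ − V` avoids `(−∞,0]`, then for `k ∈ {−1,…,n−1}` and `m ∈ {1,…,n+3−k}`,
`ψ_k^{(m)} = λ^k V_λ^{−k/4} Σ_{j=0}^{k+m} d_{k+m,j}/V_λ^j` with
`d_{k+m,j} ∈ D_{k+m,j}`, and `d_{r,0} = 0` for `r ≥ 1`. -/
theorem statement_4 (n : ℕ) (lam : ℂ) (hlam : lam ≠ 0) (V : ℝ → ℂ) (U : Set ℝ)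
    (hU : IsOpen U)
    (hV : ∀ m < n + 3, ∀ x ∈ U, DifferentiableAt ℝ (iteratedDeriv m V) x)
    (hslit : ∀ x ∈ U, ¬((lam - V x).re ≤ 0 ∧ (lam - V x).im = 0))
    (ψ : ℤ → ℝ → ℂ) (hψ : WKBRec n lam V U ψ) :
    ∀ k : ℤ, -1 ≤ k → k ≤ (n:ℤ) - 1 → ∀ m : ℕ, 1 ≤ m → (m:ℤ) ≤ (n:ℤ) + 3 - k →
      ∃ d : ℕ → ℝ → ℂ,
        (∀ j ≤ (k + m).toNat, d j ∈ Dset V (k + m).toNat j) ∧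
        (1 ≤ (k + m).toNat → d 0 = fun _ => 0) ∧
        ∀ x ∈ U, iteratedDeriv m (ψ k) x
          = lam ^ k * (lam - V x) ^ (-(k:ℂ)/4) *
              ∑ j ∈ Finset.range ((k + m).toNat + 1), d j x / (lam - V x) ^ j := by
  intro k hk hkn m hm hkm
  have hslit' : ∀ x ∈ U, lam - V x ∈ Complex.slitPlane := fun x hx => by
    rw [Complex.mem_slitPlane_iff]
    by_contra! h
    exact hslit x hx h
  obtain ⟨g, hg, hfg⟩ :=
    hψ.wkbForm hlam hU hV hslit' (k + 2).toNat k (by omega) hkn m hm hk (by omega)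
  rw [← Int.toNat_of_nonneg hg.nonneg] at hg
  obtain ⟨d, hd, hgd⟩ := hg.exists_Dset
  exact ⟨d, fun j _ => hd j, fun h => eq_zero_of_mem_Dset_zero h (hd 0),
    fun x hx => by rw [hfg x hx, hgd]⟩
end
end

section
/- Let λ ∈ ℂ∖{0}, let U ⊂ ℝ be an open interval, let V:U→ℂ be four times differentiable with V_λ(x) := λ − V(x) ∈ ℂ∖(−∞,0] for all x ∈ U, and let ψ:U→ℂ satisfy ψ'(x) = i λ^{−1} V_λ(x)^{1/4} on U (principal fourth root). Then on U: −λψ'''' + 4λ²ψ'ψ''' + 3λ²(ψ'')² − 6λ³(ψ')²ψ'' = i V_λ^{1/4}·[ (1/4)V'''/V_λ + (9/16)V'V''/V_λ² + (21/64)(V')³/V_λ³ ] + V_λ^{1/2}·[ V''/V_λ + (9/16)(V')²/V_λ² ] + i V_λ^{3/4}·[ −(3/2)V'/V_λ ], where all fractional powers of V_λ are principal powers. -/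
open Filter Set

noncomputable section

/-- A formula for `iteratedDeriv n f` on an open set can be differentiated there. -/
theorem eqOn_iteratedDeriv_succ {f F F' : ℝ → ℂ} {s : Set ℝ} (hs : IsOpen s) {n : ℕ}
    (h : EqOn (iteratedDeriv n f) F s) (hF : ∀ x ∈ s, HasDerivAt F (F' x) x) :
    EqOn (iteratedDeriv (n + 1) f) F' s := fun x hx => by
  rw [iteratedDeriv_succ, (h.eventuallyEq_of_mem (hs.mem_nhds hx)).deriv_eq]
  exact (hF x hx).deriv

/-- Derivative of a principal power along a real curve in the slit plane. -/
theorem hasDerivAt_cpow_of_mem_slitPlane {W : ℝ → ℂ} {W' : ℂ} {x : ℝ} (c : ℂ)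
    (hW : HasDerivAt W W' x) (hx : W x ∈ Complex.slitPlane) :
    HasDerivAt (fun y => W y ^ c) (c * W x ^ c * W' / W x) x := by
  have h := ((hasDerivAt_id (W x)).cpow_const (c := c) hx).comp x hW
  refine h.congr_deriv ?_
  simp only [id, Complex.cpow_sub _ _ (Complex.slitPlane_ne_zero hx), Complex.cpow_one]
  ring

/-- explicit formula for the zeroth-order WKB remainder of the
biharmonic operator.  Here `ψ' = i λ⁻¹ (λ−V)^{1/4}` (principal fourth root, i.e.
complex `cpow`) on an open interval `U` where `λ − V` avoids `(−∞,0]`. -/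
theorem statement_7 (lam : ℂ) (hlam : lam ≠ 0) (a b : ℝ) (V ψ : ℝ → ℂ)
    (hV : ∀ n < 4, ∀ x ∈ Set.Ioo a b, DifferentiableAt ℝ (iteratedDeriv n V) x)
    (hslit : ∀ x ∈ Set.Ioo a b, ¬((lam - V x).re ≤ 0 ∧ (lam - V x).im = 0))
    (hψ : ∀ x ∈ Set.Ioo a b,
      deriv ψ x = Complex.I * lam⁻¹ * (lam - V x) ^ ((1:ℂ)/4)) :
    ∀ x ∈ Set.Ioo a b,
      -lam * iteratedDeriv 4 ψ x
          + 4 * lam ^ 2 * deriv ψ x * iteratedDeriv 3 ψ x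
          + 3 * lam ^ 2 * (iteratedDeriv 2 ψ x) ^ 2
          - 6 * lam ^ 3 * (deriv ψ x) ^ 2 * iteratedDeriv 2 ψ x
        = Complex.I * (lam - V x) ^ ((1:ℂ)/4) *
              ((1/4) * iteratedDeriv 3 V x / (lam - V x)
                + (9/16) * deriv V x * iteratedDeriv 2 V x / (lam - V x) ^ 2
                + (21/64) * (deriv V x) ^ 3 / (lam - V x) ^ 3)
          + (lam - V x) ^ ((1:ℂ)/2) *
              (iteratedDeriv 2 V x / (lam - V x)
                + (9/16) * (deriv V x) ^ 2 / (lam - V x) ^ 2)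
          + Complex.I * (lam - V x) ^ ((3:ℂ)/4) *
              (-(3/2) * deriv V x / (lam - V x)) := by
  have hs : IsOpen (Ioo a b) := isOpen_Ioo
  have hW : ∀ x ∈ Ioo a b, lam - V x ∈ Complex.slitPlane := fun x hx => by
    have := hslit x hx
    rw [Complex.mem_slitPlane_iff]
    by_contra! h
    exact this h
  have hW0 : ∀ x ∈ Ioo a b, lam - V x ≠ 0 := fun x hx => Complex.slitPlane_ne_zero (hW x hx)
  have hVn : ∀ n < 4, ∀ x ∈ Ioo a b,
      HasDerivAt (iteratedDeriv n V) (iteratedDeriv (n + 1) V x) x := fun n hn x hx => by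
    rw [iteratedDeriv_succ]
    exact (hV n hn x hx).hasDerivAt
  have hV0 : ∀ x ∈ Ioo a b, HasDerivAt V (iteratedDeriv 1 V x) x := fun x hx => by
    simpa using hVn 0 (by norm_num) x hx
  have hWd : ∀ x ∈ Ioo a b, HasDerivAt (fun y => lam - V y) (-iteratedDeriv 1 V x) x :=
    fun x hx => (hV0 x hx).const_sub lam
  have hw : ∀ x ∈ Ioo a b, HasDerivAt (fun y => (lam - V y) ^ ((1:ℂ)/4))
      ((1/4) * (lam - V x) ^ ((1:ℂ)/4) * (-iteratedDeriv 1 V x) / (lam - V x)) x :=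
    fun x hx => hasDerivAt_cpow_of_mem_slitPlane _ (hWd x hx) (hW x hx)
  have h1 : EqOn (iteratedDeriv 1 ψ)
      (fun x => Complex.I * lam⁻¹ * (lam - V x) ^ ((1:ℂ)/4)) (Ioo a b) := fun x hx => by
    rw [iteratedDeriv_one]
    exact hψ x hx
  have h2 : EqOn (iteratedDeriv 2 ψ)
      (fun x => -(Complex.I * lam⁻¹ / 4) *
        ((lam - V x) ^ ((1:ℂ)/4) * (iteratedDeriv 1 V x / (lam - V x)))) (Ioo a b) :=
    eqOn_iteratedDeriv_succ hs h1 fun x hx =>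
      ((hw x hx).const_mul _).congr_deriv (by ring)
  have h3 : EqOn (iteratedDeriv 3 ψ)
      (fun x => -(Complex.I * lam⁻¹ / 4) * ((lam - V x) ^ ((1:ℂ)/4) *
        (iteratedDeriv 2 V x / (lam - V x)
          + 3 / 4 * (iteratedDeriv 1 V x ^ 2 / (lam - V x) ^ 2)))) (Ioo a b) :=
    eqOn_iteratedDeriv_succ hs h2 fun x hx => by
      have hx0 := hW0 x hx
      refine (((hw x hx).mul ((hVn 1 (by norm_num) x hx).div (hWd x hx) hx0)).const_mul
        _).congr_deriv ?_
      simp only [Pi.div_apply]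
      field_simp
      ring
  have h4 : EqOn (iteratedDeriv 4 ψ)
      (fun x => -(Complex.I * lam⁻¹ / 4) * ((lam - V x) ^ ((1:ℂ)/4) *
        (iteratedDeriv 3 V x / (lam - V x)
          + 9 / 4 * (iteratedDeriv 1 V x * iteratedDeriv 2 V x / (lam - V x) ^ 2)
          + 21 / 16 * (iteratedDeriv 1 V x ^ 3 / (lam - V x) ^ 3)))) (Ioo a b) :=
    eqOn_iteratedDeriv_succ hs h3 fun x hx => by
      have hx0 := hW0 x hx
      have hd := ((hVn 2 (by norm_num) x hx).div (hWd x hx) hx0).add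
        ((((hVn 1 (by norm_num) x hx).pow 2).div ((hWd x hx).pow 2)
          (pow_ne_zero 2 hx0)).const_mul (3 / 4))
      refine (((hw x hx).mul hd).const_mul _).congr_deriv ?_
      simp only [Pi.div_apply, Pi.add_apply, Pi.pow_apply]
      field_simp
      ring
  intro x hx
  have hx0 := hW0 x hx
  have hhalf : (lam - V x) ^ ((1:ℂ)/2) = ((lam - V x) ^ ((1:ℂ)/4)) ^ 2 := by
    rw [← Complex.cpow_nat_mul]
    norm_num
  have hthree : (lam - V x) ^ ((3:ℂ)/4) = ((lam - V x) ^ ((1:ℂ)/4)) ^ 3 := by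
    rw [← Complex.cpow_nat_mul]
    norm_num
  rw [hψ x hx, h2 hx, h3 hx, h4 hx, hhalf, hthree, ← iteratedDeriv_one (f := V)]
  beta_reduce
  generalize (lam - V x) ^ ((1:ℂ)/4) = w
  generalize lam - V x = W at hx0 ⊢
  field_simp
  ring_nf
  simp only [Complex.I_sq, Complex.I_pow_three]
  ring
end
end
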